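/- Let X be a normed vector space over ℝ or ℂ and T : X → X a bounded linear operator. Then T has only one chain recurrent class: any two chain recurrent points x and y of T satisfy that for every ε > 0 there is an ε-chain from x to y and an ε-chain from y to x. -/

import Mathlib

/-- An `ε`-chain of `T` from `x` to `y`: a finite sequence `x = c 0, c 1, …, c n = y`
with `n ≥ 1` such that `‖T (c i) - c (i+1)‖ < ε` for every `0 ≤ i < n`. -/
def EpsChain {E : Type*} [NormedAddCommGroup E] (T : E → E) (ε : ℝ) (x y : E) : Prop :=
  ∃ (n : ℕ) (c : ℕ → E), 1 ≤ n ∧ c 0 = x ∧ c n = y ∧ ∀ i < n, ‖T (c i) - c (i + 1)‖ < ε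

/-- `x` is a chain recurrent point of `T` if for every `ε > 0` there is an `ε`-chain
beginning and ending at `x`. -/
def ChainRecurrent {E : Type*} [NormedAddCommGroup E] (T : E → E) (x : E) : Prop :=
  ∀ ε > 0, EpsChain T ε x x

theorem EpsChain.trans {E : Type*} [NormedAddCommGroup E] {T : E → E} {ε : ℝ} {x y z : E}
    (hxy : EpsChain T ε x y) (hyz : EpsChain T ε y z) : EpsChain T ε x z := by
  obtain ⟨n, c, hn, hc0, hcn, hc⟩ := hxy
  obtain ⟨m, d, hm, hd0, hdm, hd⟩ := hyz
  refine ⟨n + m, fun i => if i < n then c i else d (i - n), by omega, ?_, ?_, ?_⟩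
  · simp only [if_pos (show 0 < n by omega), hc0]
  · simp [hdm]
  · intro i hi
    by_cases h : i + 1 < n
    · simpa only [if_pos h, if_pos (show i < n by omega)] using hc i (by omega)
    by_cases h' : i < n
    · obtain rfl : n = i + 1 := by omega
      simpa [hd0, hcn] using hc i (by omega)
    · simpa only [if_neg h, if_neg h', show i + 1 - n = i - n + 1 by omega]
        using hd (i - n) (by omega)

/-- A closed chain can be unrolled to a periodic, hence bounded, infinite chain. -/
theorem EpsChain.exists_periodic {E : Type*} [NormedAddCommGroup E] {T : E → E} {ε : ℝ} {x : E}
    (h : EpsChain T ε x x) :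
    ∃ (n : ℕ) (c : ℕ → E) (M : ℝ), 1 ≤ n ∧ (∀ k, c (k * n) = x) ∧
      (∀ i, ‖T (c i) - c (i + 1)‖ < ε) ∧ ∀ i, ‖c i‖ ≤ M := by
  obtain ⟨n, c, hn, hc0, hcn, hc⟩ := h
  refine ⟨n, fun i => c (i % n), ∑ i ∈ Finset.range n, ‖c i‖, hn, fun k => by simpa using hc0,
    fun i => ?_, fun i => ?_⟩
  · have hi : i % n < n := Nat.mod_lt _ hn
    have key : c ((i + 1) % n) = c (i % n + 1) := by
      rw [← Nat.mod_add_mod]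
      rcases Nat.lt_or_ge (i % n + 1) n with h | h
      · rw [Nat.mod_eq_of_lt h]
      · rw [show i % n + 1 = n by omega, Nat.mod_self, hc0, hcn]
    simpa only [key] using hc _ hi
  · exact Finset.single_le_sum (f := fun i => ‖c i‖) (fun _ _ => norm_nonneg _)
      (Finset.mem_range.2 (Nat.mod_lt _ hn))

/-- Rescaling a periodic chain slowly joins any two multiples of a chain recurrent point with
coefficients in the unit interval. -/
theorem ChainRecurrent.epsChain_smul {E : Type*} [NormedAddCommGroup E] [NormedSpace ℝ E]
    {T : E →L[ℝ] E} {x : E} (hx : ChainRecurrent T x) {a b : ℝ} (ha : a ∈ Set.Icc (0 : ℝ) 1)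
    (hb : b ∈ Set.Icc (0 : ℝ) 1) {ε : ℝ} (hε : 0 < ε) : EpsChain T ε (a • x) (b • x) := by
  obtain ⟨n, c, M, hn, hcx, hc, hM⟩ := (hx (ε / 2) (half_pos hε)).exists_periodic
  obtain ⟨k, hk⟩ := exists_nat_gt (M / (ε / 2))
  have hM0 : 0 ≤ M := (norm_nonneg _).trans (hM 0)
  have hk0 : (0 : ℝ) < k := (by positivity : 0 ≤ M / (ε / 2)).trans_lt hk
  have hkn : (k : ℝ) ≤ (k * n : ℕ) := by exact_mod_cast Nat.le_mul_of_pos_right k hn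
  have hN : (0 : ℝ) < (k * n : ℕ) := hk0.trans_le hkn
  have hMN : M / (k * n : ℕ) < ε / 2 := by
    rw [div_lt_iff₀ (half_pos hε)] at hk
    rw [div_lt_iff₀ hN]
    nlinarith
  generalize hNdef : k * n = N at *
  refine ⟨N, fun i => AffineMap.lineMap a b ((i : ℝ) / N) • c i, by exact_mod_cast hN, ?_, ?_, ?_⟩
  · have h0 : c 0 = x := by simpa using hcx 0
    simp [h0]
  · have hN' : c N = x := hNdef ▸ hcx k
    simp [hN', div_self hN.ne']
  · intro i hi
    set l : ℝ := AffineMap.lineMap a b ((i : ℝ) / N) with hl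
    have hl1 : |l| ≤ 1 := by
      have : l ∈ Set.Icc (0 : ℝ) 1 := (convex_Icc (0 : ℝ) 1).lineMap_mem ha hb
        ⟨by positivity, by rw [div_le_one hN]; exact_mod_cast hi.le⟩
      exact abs_le.2 ⟨by linarith [this.1], this.2⟩
    have hstep : AffineMap.lineMap a b (((i + 1 : ℕ) : ℝ) / N) = l + (b - a) / N := by
      simp only [hl, AffineMap.lineMap_apply_ring', Nat.cast_add, Nat.cast_one]
      ring
    have hba : |(b - a) / N| ≤ 1 / N := by
      rw [abs_div, abs_of_pos hN]
      gcongr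
      exact abs_le.2 ⟨by linarith [ha.2, hb.1], by linarith [ha.1, hb.2]⟩
    have hsplit : T (l • c i) - (l + (b - a) / N) • c (i + 1) =
        l • (T (c i) - c (i + 1)) - ((b - a) / N) • c (i + 1) := by
      rw [map_smul]
      module
    beta_reduce
    rw [hstep, ← hl, hsplit]
    calc _ ≤ |l| * ‖T (c i) - c (i + 1)‖ + |(b - a) / N| * ‖c (i + 1)‖ := by
          simpa only [norm_smul, Real.norm_eq_abs] using
            norm_sub_le (l • (T (c i) - c (i + 1))) (((b - a) / N) • c (i + 1))
      _ ≤ 1 * ‖T (c i) - c (i + 1)‖ + 1 / N * M := by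
          gcongr
          exact hM _
      _ < ε := by
          have := hc i
          rw [one_mul, one_div_mul_eq_div]
          linarith

/-- Any two chain recurrent points of a real bounded operator are joined by a chain through `0`. -/
theorem ChainRecurrent.epsChain {E : Type*} [NormedAddCommGroup E] [NormedSpace ℝ E]
    {T : E →L[ℝ] E} {x y : E} (hx : ChainRecurrent T x) (hy : ChainRecurrent T y) {ε : ℝ}
    (hε : 0 < ε) : EpsChain T ε x y := by
  have h0 : (0 : ℝ) ∈ Set.Icc (0 : ℝ) 1 := by simp
  have h1 : (1 : ℝ) ∈ Set.Icc (0 : ℝ) 1 := by simp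
  have hx0 := hx.epsChain_smul h1 h0 hε
  have h0y := hy.epsChain_smul h0 h1 hε
  rw [one_smul, zero_smul] at hx0 h0y
  exact hx0.trans h0y

theorem stmt_1 {𝕜 : Type*} [RCLike 𝕜] {X : Type*} [NormedAddCommGroup X] [NormedSpace 𝕜 X]
    (T : X →L[𝕜] X) (x y : X) (hx : ChainRecurrent (⇑T) x) (hy : ChainRecurrent (⇑T) y) :
    ∀ ε > 0, EpsChain (⇑T) ε x y ∧ EpsChain (⇑T) ε y x := by
  intro ε hε
  let _ : NormedSpace ℝ X := NormedSpace.restrictScalars ℝ 𝕜 X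
  have hx' : ChainRecurrent (T.restrictScalars ℝ) x := hx
  have hy' : ChainRecurrent (T.restrictScalars ℝ) y := hy
  exact ⟨hx'.epsChain hy' hε, hy'.epsChain hx' hε⟩
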